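/- (Orthogonal Procrustes) Let A, B ∈ ℝ^{D×N} and suppose B Aᵀ = U S Vᵀ where U, V ∈ ℝ^{D×D} are orthogonal matrices and S ∈ ℝ^{D×D} is a diagonal matrix with nonnegative diagonal entries. Then W° = U Vᵀ minimizes ‖W A − B‖_F² over all orthogonal matrices W ∈ ℝ^{D×D}: for every orthogonal W, ‖W° A − B‖_F² ≤ ‖W A − B‖_F². -/

import Mathlib

open Matrix

/-- Squared Frobenius norm: `‖A‖_F² = tr(Aᵀ A)`. -/
noncomputable def frobSq {m n : Type*} [Fintype m] [Fintype n] (A : Matrix m n ℝ) : ℝ :=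
  (Aᵀ * A).trace

theorem procrustes_expand (D N : ℕ)
    (A B : Matrix (Fin D) (Fin N) ℝ)
    (U V S : Matrix (Fin D) (Fin D) ℝ)
    (hSdiag : ∀ i j, i ≠ j → S i j = 0)
    (hSVD : B * Aᵀ = U * S * Vᵀ) (W : Matrix (Fin D) (Fin D) ℝ) (hW : Wᵀ * W = 1) :
    frobSq (W * A - B) = (Aᵀ * A).trace + (Bᵀ * B).trace
      - 2 * ∑ i, (Vᵀ * Wᵀ * U) i i * S i i := by
  have h1 : (Aᵀ * Wᵀ * (W * A)) = Aᵀ * A := by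
    rw [Matrix.mul_assoc, ← Matrix.mul_assoc Wᵀ, hW, Matrix.one_mul]
  have h2 : (Bᵀ * (W * A)).trace = (Aᵀ * Wᵀ * B).trace := by
    rw [← Matrix.trace_transpose]
    simp [Matrix.transpose_mul]
  have h3 : (Aᵀ * Wᵀ * B).trace = ∑ i, (Vᵀ * Wᵀ * U) i i * S i i := by
    rw [Matrix.mul_assoc, Matrix.trace_mul_comm, Matrix.mul_assoc, hSVD,
      ← Matrix.mul_assoc, Matrix.trace_mul_comm, ← Matrix.mul_assoc, ← Matrix.mul_assoc,
      Matrix.trace]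
    refine Finset.sum_congr rfl fun i _ => ?_
    rw [Matrix.diag_apply, Matrix.mul_apply]
    refine Finset.sum_eq_single i (fun j _ hj => ?_) (by simp)
    rw [hSdiag j i hj, mul_zero]
  unfold frobSq
  rw [Matrix.transpose_sub, Matrix.transpose_mul, Matrix.sub_mul, Matrix.mul_sub, Matrix.mul_sub,
    Matrix.trace_sub, Matrix.trace_sub, Matrix.trace_sub, h1, h2, h3]
  ring

theorem orth_diag_le_one (D : ℕ) (Z : Matrix (Fin D) (Fin D) ℝ) (hZ : Zᵀ * Z = 1) (i : Fin D) :
    Z i i ≤ 1 := by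
  have h : ∑ j, Z j i * Z j i = 1 := by
    have := congrFun (congrFun hZ i) i
    simpa [Matrix.mul_apply] using this
  have h2 : Z i i * Z i i ≤ ∑ j, Z j i * Z j i :=
    Finset.single_le_sum (f := fun j => Z j i * Z j i)
      (fun j _ => mul_self_nonneg _) (Finset.mem_univ i)
  nlinarith

/-- Orthogonal Procrustes: if `B Aᵀ = U S Vᵀ` with `U, V` orthogonal and `S`
diagonal with nonnegative entries, then `W° = U Vᵀ` minimizes `‖W A − B‖_F²` over orthogonal
matrices `W`. -/
theorem stmt11 (D N : ℕ) (hD : 0 < D) (hN : 0 < N)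
    (A B : Matrix (Fin D) (Fin N) ℝ)
    (U V S : Matrix (Fin D) (Fin D) ℝ)
    (hU : Uᵀ * U = 1) (hV : Vᵀ * V = 1)
    (hSdiag : ∀ i j, i ≠ j → S i j = 0) (hSnn : ∀ i, 0 ≤ S i i)
    (hSVD : B * Aᵀ = U * S * Vᵀ) :
    ∀ W : Matrix (Fin D) (Fin D) ℝ, Wᵀ * W = 1 →
      frobSq ((U * Vᵀ) * A - B) ≤ frobSq (W * A - B) := by
  intro W hW
  have hV' : V * Vᵀ = 1 := mul_eq_one_comm.mp hV
  have hU' : U * Uᵀ = 1 := mul_eq_one_comm.mp hU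
  have hW' : W * Wᵀ = 1 := mul_eq_one_comm.mp hW
  have h0 : (U * Vᵀ)ᵀ * (U * Vᵀ) = 1 := by
    rw [Matrix.transpose_mul, Matrix.transpose_transpose, Matrix.mul_assoc,
      ← Matrix.mul_assoc Uᵀ, hU, Matrix.one_mul, hV']
  have hZ0 : Vᵀ * (U * Vᵀ)ᵀ * U = 1 := by
    rw [Matrix.transpose_mul, Matrix.transpose_transpose, ← Matrix.mul_assoc, hV,
      Matrix.one_mul, hU]
  have hZ : (Vᵀ * Wᵀ * U)ᵀ * (Vᵀ * Wᵀ * U) = 1 := by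
    simp only [Matrix.transpose_mul, Matrix.transpose_transpose, Matrix.mul_assoc]
    rw [← Matrix.mul_assoc V, hV', Matrix.one_mul, ← Matrix.mul_assoc W, hW', Matrix.one_mul, hU]
  rw [procrustes_expand D N A B U V S hSdiag hSVD _ h0,
    procrustes_expand D N A B U V S hSdiag hSVD W hW, hZ0]
  have : ∑ i, (Vᵀ * Wᵀ * U) i i * S i i ≤
      ∑ i, (1 : Matrix (Fin D) (Fin D) ℝ) i i * S i i := by
    refine Finset.sum_le_sum fun i _ => ?_
    rw [Matrix.one_apply_eq]
    exact mul_le_mul_of_nonneg_right (orth_diag_le_one D _ hZ i) (hSnn i)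
  linarith
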